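/- With the admissible system of neighborhoods Vᵢ^l as in the context, let d ≥ 2, m₀ ≥ 1, t₀ ≥ 1 with m₁ = m₀·t₀. Let (P_n)_{n≥1} be polynomials of degree d with P_n^{m₀}(0) = 0, converging coefficientwise to a polynomial P₀ of degree d with P₀^{m₀}(0) = 0; set ρ_n := (P_n^{m₀})'(0) and assume |ρ_n| > 1 for all n and that ρ₀ := (P₀^{m₀})'(0) is a primitive t₀-th root of unity. For a polynomial P with P^{m₀}(0) = 0 set bᵢ(P) := (P^{m₁−i−1})'(P^{i+1}(0)) for 0 ≤ i ≤ m₁−1, and define cⱼ := Σ_{i=0}^{m₁−1} bᵢ(P₀)·q^i(rⱼ) for j ∈ {1,2,3}. Then for all α₀ > 0, ε₀ > 0 and δ₀ > 0 there exist a sequence of integers l_n ≥ l₀, complex numbers ρ'_n with |ρ'_n| = 1+α₀, reals s_n ∈ (0,1), and N ≥ 1 such that for every n ≥ N and every s ∈ ℂ with 0 < |s| ≤ s_n the following holds: setting ε_n := ε₀·(ρ_n^{t₀} − 1)/(ρ_n^{t₀·l_n} − 1), f(z,w) := (P_n(z) + s·ε_n·w, q(w)), φ(z,w) := (sz, w)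 and g := φ⁻¹ ∘ f ∘ φ, the map G := g^{m₁·l_n} has the form G(z,w) = (H(z,w), q^{m₁·l_n}(w)) with (i) |H(z,w) − (ρ'_n·z + ε₀·cⱼ)| ≤ δ₀ for all (z,w) ∈ 2𝔻 × Vⱼ^{l_n} and j ∈ {1,2,3}, and (ii) G contracts the cone field C_{δ₀} on closure(∪_{j=1}^3 𝔻 × Vⱼ^{l_n}). -/

import Mathlib

open Metric Set

/-- An admissible system of shrinking neighborhoods around three repelling periodic points of a
polynomial `q`, as provided by Lemma 3.1 of the paper. -/
structure AdmissibleSystem where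
  /-- the degree -/
  d : ℕ
  hd : 2 ≤ d
  /-- the polynomial -/
  q : Polynomial ℂ
  hq : q.natDegree = d
  /-- the period -/
  m₁ : ℕ
  hm₁ : 1 ≤ m₁
  /-- the three repelling periodic points -/
  r : Fin 3 → ℂ
  hr : Function.Injective r
  hper : ∀ i, (fun w => q.eval w)^[m₁] (r i) = r i
  hrep : ∀ i, 1 < ‖deriv ((fun w => q.eval w)^[m₁]) (r i)‖
  hpc : ∀ i, r i ∉ ⋃ n : ℕ, (fun w => q.eval w)^[n + 1] '' {w : ℂ | q.derivative.eval w = 0}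
  /-- the expansion constant -/
  A : ℝ
  hA : 0 < A
  /-- the threshold index -/
  l₀ : ℕ
  hl₀ : 1 ≤ l₀
  /-- constants controlling the diameters -/
  a₁ : ℝ
  ha₁ : 0 < a₁
  a₂ : ℝ
  ha₂ : 0 < a₂
  ha₂' : a₂ < 1
  /-- the neighborhoods -/
  V : Fin 3 → ℕ → Set ℂ
  hVopen : ∀ i l, IsOpen (V i l)
  hVconn : ∀ i l, IsConnected (V i l)
  hVmem : ∀ i l, r i ∈ V i l
  hVmap : ∀ i l, (fun w => q.eval w)^[m₁] '' V i (l + 1) = V i l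
  hVdiam : ∀ i l, EMetric.diam (V i l) ≤ ENNReal.ofReal (a₁ * a₂ ^ l)
  hVexp : ∀ l, l₀ ≤ l → ∀ i, ∀ w ∈ V i l,
    A * ‖deriv ((fun w => q.eval w)^[m₁]) (r i)‖ ^ l ≤
      ‖deriv ((fun w => q.eval w)^[l * m₁]) w‖
  hVexp1 : ∀ l, l₀ ≤ l → ∀ i, 1 < A * ‖deriv ((fun w => q.eval w)^[m₁]) (r i)‖ ^ l
  hVcover : ∀ l, l₀ ≤ l → ∀ i,
    closure (V 0 l ∪ V 1 l ∪ V 2 l) ⊆ (fun w => q.eval w)^[l * m₁] '' V i l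
  hVbij : ∀ l, l₀ ≤ l → ∀ i j, Set.BijOn ((fun w => q.eval w)^[l * m₁])
    (V i l ∩ (fun w => q.eval w)^[l * m₁] ⁻¹' V j l) (V j l)

/-- The cone `C_δ = {(a,b) ∈ ℂ² | |a| < δ |b|}`, viewed as a constant cone field on `ℂ²`. -/
def cone (δ : ℝ) : Set (ℂ × ℂ) := {v : ℂ × ℂ | ‖v.1‖ < δ * ‖v.2‖}

/-- A map `g : ℂ² → ℂ²` contracts the cone field `C_δ` on `U` if there is `0 < δ' < δ` such
that the derivative of `g` at every point of `U` maps `C_δ` into `C_{δ'}`. -/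
def ContractsCone (g : ℂ × ℂ → ℂ × ℂ) (δ : ℝ) (U : Set (ℂ × ℂ)) : Prop :=
  ∃ δ' : ℝ, 0 < δ' ∧ δ' < δ ∧ ∀ x ∈ U, ∀ v ∈ cone δ, fderiv ℂ g x v ∈ cone δ'


open Filter Topology

noncomputable section

/-- first-order Taylor remainder factor -/
def rem19 (P : Polynomial ℂ) (p h : ℂ) : ℂ :=
  ∑ k ∈ Finset.range (P.natDegree + 1), (Polynomial.hasseDeriv (k + 1) P).eval p * h ^ k

/-- extended map including the scale parameter -/
def ext19 (P q : Polynomial ℂ) (ε : ℂ) (u : ℂ × ℂ × ℂ × ℂ) : ℂ × ℂ × ℂ × ℂ :=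
  (u.1, P.eval u.2.1, u.2.2.1 * rem19 P u.2.1 (u.1 * u.2.2.1) + ε * u.2.2.2, q.eval u.2.2.2)

end

lemma rem19_spec (P : Polynomial ℂ) (p h : ℂ) : P.eval (p + h) = P.eval p + h * rem19 P p h := by
  have h1 : P.eval (p + h) = (Polynomial.taylor p P).eval h := by
    rw [Polynomial.taylor_eval, add_comm]
  rw [h1, Polynomial.eval_eq_sum_range' (n := P.natDegree + 2) (by
    rw [Polynomial.natDegree_taylor]; omega), Finset.sum_range_succ']
  simp only [Polynomial.taylor_coeff, Polynomial.hasseDeriv_zero, pow_zero, mul_one, rem19,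
    Finset.mul_sum]
  rw [add_comm]
  congr 1
  refine Finset.sum_congr rfl fun k _ => ?_
  ring

lemma rem19_zero (P : Polynomial ℂ) (p : ℂ) : rem19 P p 0 = P.derivative.eval p := by
  rw [rem19, Finset.sum_range_succ']
  simp [Polynomial.hasseDeriv_one]

lemma contDiff_ext19 (P q : Polynomial ℂ) (ε : ℂ) : ContDiff ℂ 2 (ext19 P q ε) := by
  have hp : ∀ p : Polynomial ℂ, ContDiff ℂ 2 (fun z : ℂ => p.eval z) := fun p => by
    simpa using p.contDiff_aeval (n := 2) (𝕜 := ℂ) 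
  have a1 : ContDiff ℂ 2 (fun u : ℂ × ℂ × ℂ × ℂ => u.1) := by fun_prop
  have a2 : ContDiff ℂ 2 (fun u : ℂ × ℂ × ℂ × ℂ => u.2.1) := by fun_prop
  have a3 : ContDiff ℂ 2 (fun u : ℂ × ℂ × ℂ × ℂ => u.2.2.1) := by fun_prop
  have a4 : ContDiff ℂ 2 (fun u : ℂ × ℂ × ℂ × ℂ => u.2.2.2) := by fun_prop
  refine a1.prodMk (((hp P).comp a2).prodMk (ContDiff.prodMk ?_ ((hp q).comp a4)))
  refine (a3.mul ?_).add (contDiff_const.mul a4)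
  unfold rem19
  refine ContDiff.sum fun k _ => ?_
  exact ((hp _).comp a2).mul ((a1.mul a3).pow k)

lemma contDiff_ext19_iter (P q : Polynomial ℂ) (ε : ℂ) (N : ℕ) :
    ContDiff ℂ 2 ((ext19 P q ε)^[N]) := by
  induction N with
  | zero => exact contDiff_id
  | succ N ih => exact ih.comp (contDiff_ext19 P q ε)

lemma ext19_iter_conj (P q : Polynomial ℂ) (ε s : ℂ) (hs : s ≠ 0) (x : ℂ × ℂ) (N : ℕ) :
    ((ext19 P q ε)^[N] (s, 0, x)).1 = s ∧
    ((ext19 P q ε)^[N] (s, 0, x)).2.1 = (fun z => P.eval z)^[N] 0 ∧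
    (fun x : ℂ × ℂ => ((P.eval (s * x.1) + s * ε * x.2) / s, q.eval x.2))^[N] x =
      ((((ext19 P q ε)^[N] (s, 0, x)).2.1 + s * ((ext19 P q ε)^[N] (s, 0, x)).2.2.1) / s,
        ((ext19 P q ε)^[N] (s, 0, x)).2.2.2) := by
  induction N with
  | zero => simp [hs]
  | succ N ih =>
    obtain ⟨h1, h2, h3⟩ := ih
    simp only [Function.iterate_succ_apply'] at *
    rw [h3]
    generalize (ext19 P q ε)^[N] (s, 0, x) = u at *
    obtain ⟨u1, u2, u3, u4⟩ := u
    simp only at h1 h2 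
    subst h1
    refine ⟨rfl, by simp [ext19, ← h2], ?_⟩
    simp only [ext19, Prod.mk.injEq, and_true]
    rw [mul_div_cancel₀ _ hs, rem19_spec]
    field_simp
    ring

lemma base_iter (f : ℂ × ℂ → ℂ × ℂ) (h : ℂ → ℂ) (hf : ∀ x, (f x).2 = h x.2) (N : ℕ) (x : ℂ × ℂ) :
    (f^[N] x).2 = h^[N] x.2 := by
  induction N with
  | zero => rfl
  | succ N ih => rw [Function.iterate_succ_apply', Function.iterate_succ_apply', hf, ih]

lemma diff_iter (P : Polynomial ℂ) (k : ℕ) : Differentiable ℂ ((fun z => P.eval z)^[k]) :=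
  Differentiable.iterate P.differentiable k

lemma deriv_iter_add (P : Polynomial ℂ) (j k : ℕ) (x : ℂ) :
    deriv ((fun z => P.eval z)^[j + k]) x =
      deriv ((fun z => P.eval z)^[j]) ((fun z => P.eval z)^[k] x) *
        deriv ((fun z => P.eval z)^[k]) x := by
  rw [Function.iterate_add, deriv_comp _ (diff_iter P j _) (diff_iter P k _)]

lemma deriv_iter_one (P : Polynomial ℂ) (x : ℂ) :
    deriv ((fun z => P.eval z)^[1]) x = P.derivative.eval x := by
  rw [Function.iterate_one, Polynomial.deriv]

/-- scale zero dynamics -/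
lemma ext19_zero_iter (P q : Polynomial ℂ) (ε p y w : ℂ) (N : ℕ) :
    (ext19 P q ε)^[N] (0, p, y, w) = (0, (fun z => P.eval z)^[N] p,
      deriv ((fun z => P.eval z)^[N]) p * y + ε * ∑ i ∈ Finset.range N,
        deriv ((fun z => P.eval z)^[N - i - 1]) ((fun z => P.eval z)^[i + 1] p) *
          (fun w => q.eval w)^[i] w, (fun w => q.eval w)^[N] w) := by
  induction N with
  | zero => simp
  | succ N ih =>
    rw [Function.iterate_succ_apply', ih]
    simp only [ext19, zero_mul, rem19_zero, Prod.mk.injEq, Function.iterate_succ_apply', true_and,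
      and_true]
    rw [add_comm N 1, deriv_iter_add, deriv_iter_one, add_comm 1 N, Finset.sum_range_succ]
    have : ∀ i ∈ Finset.range N, deriv ((fun z => P.eval z)^[N + 1 - i - 1])
        (P.eval ((fun z => P.eval z)^[i] p)) * (fun w => q.eval w)^[i] w =
        P.derivative.eval ((fun z => P.eval z)^[N] p) * (deriv ((fun z => P.eval z)^[N - i - 1])
        (P.eval ((fun z => P.eval z)^[i] p)) * (fun w => q.eval w)^[i] w) := by
      intro i hi
      have hi := Finset.mem_range.1 hi
      have e1 : N + 1 - i - 1 = 1 + (N - i - 1) := by omega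
      rw [e1, deriv_iter_add, deriv_iter_one]
      have e2 : P.eval ((fun z => P.eval z)^[i] p) = (fun z => P.eval z)^[i+1] p := by
        rw [Function.iterate_succ_apply']
      rw [e2, ← Function.iterate_add_apply, show N - i - 1 + (i + 1) = N by omega]
      ring
    rw [Finset.sum_congr rfl this, ← Finset.mul_sum]
    simp
    ring

/-- block form -/
lemma ext19_zero_block (P q : Polynomial ℂ) (ε y w : ℂ) (m l : ℕ)
    (hp : (fun z => P.eval z)^[m] 0 = 0) :
    (ext19 P q ε)^[m * l] (0, 0, y, w) = (0, 0,
      deriv ((fun z => P.eval z)^[m]) 0 ^ l * y + ε * ∑ a ∈ Finset.range l,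
        deriv ((fun z => P.eval z)^[m]) 0 ^ (l - 1 - a) * ∑ i ∈ Finset.range m,
        deriv ((fun z => P.eval z)^[m - i - 1]) ((fun z => P.eval z)^[i + 1] 0) *
          (fun w => q.eval w)^[i] ((fun w => q.eval w)^[m * a] w), (fun w => q.eval w)^[m * l] w) := by
  induction l with
  | zero => simp
  | succ l ih =>
    rw [Nat.mul_succ, add_comm (m * l) m, Function.iterate_add_apply, ih, ext19_zero_iter, hp,
      ← Function.iterate_add_apply, Finset.sum_range_succ]
    have : ∀ a ∈ Finset.range l, deriv ((fun z => P.eval z)^[m]) 0 ^ (l + 1 - 1 - a) *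
        ∑ i ∈ Finset.range m,
        deriv ((fun z => P.eval z)^[m - i - 1]) ((fun z => P.eval z)^[i + 1] 0) *
          (fun w => q.eval w)^[i] ((fun w => q.eval w)^[m * a] w) =
        deriv ((fun z => P.eval z)^[m]) 0 * (deriv ((fun z => P.eval z)^[m]) 0 ^ (l - 1 - a) *
        ∑ i ∈ Finset.range m,
        deriv ((fun z => P.eval z)^[m - i - 1]) ((fun z => P.eval z)^[i + 1] 0) *
          (fun w => q.eval w)^[i] ((fun w => q.eval w)^[m * a] w)) := by
      intro a ha
      have ha := Finset.mem_range.1 ha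
      rw [show l + 1 - 1 - a = (l - 1 - a) + 1 by omega, pow_succ]
      ring
    rw [Finset.sum_congr rfl this, ← Finset.mul_sum]
    simp only [Prod.mk.injEq, true_and, and_true]
    rw [show l + 1 - 1 - l = 0 by omega]
    ring

lemma tendsto_eval19 (P : ℕ → Polynomial ℂ) (P₀ : Polynomial ℂ) (d : ℕ)
    (hdeg : ∀ n, (P n).natDegree ≤ d) (hdeg₀ : P₀.natDegree ≤ d)
    (hconv : ∀ k : ℕ, Tendsto (fun n => (P n).coeff k) atTop (𝓝 (P₀.coeff k)))
    (x : ℕ → ℂ) (x₀ : ℂ) (hx : Tendsto x atTop (𝓝 x₀)) :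
    Tendsto (fun n => (P n).eval (x n)) atTop (𝓝 (P₀.eval x₀)) := by
  rw [Polynomial.eval_eq_sum_range' (n := d + 1) (by omega)]
  have : (fun n => (P n).eval (x n)) =
      fun n => ∑ i ∈ Finset.range (d + 1), (P n).coeff i * x n ^ i := by
    funext n
    rw [Polynomial.eval_eq_sum_range' (n := d + 1) (by have := hdeg n; omega)]
  rw [this]
  exact tendsto_finsetSum _ fun i _ => (hconv i).mul (hx.pow i)

lemma tendsto_deriv19 (P : ℕ → Polynomial ℂ) (P₀ : Polynomial ℂ) (d : ℕ)
    (hdeg : ∀ n, (P n).natDegree ≤ d) (hdeg₀ : P₀.natDegree ≤ d)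
    (hconv : ∀ k : ℕ, Tendsto (fun n => (P n).coeff k) atTop (𝓝 (P₀.coeff k)))
    (x : ℕ → ℂ) (x₀ : ℂ) (hx : Tendsto x atTop (𝓝 x₀)) (k : ℕ) :
    Tendsto (fun n => (fun z => (P n).eval z)^[k] (x n)) atTop
      (𝓝 ((fun z => P₀.eval z)^[k] x₀)) ∧
    Tendsto (fun n => deriv ((fun z => (P n).eval z)^[k]) (x n)) atTop
      (𝓝 (deriv ((fun z => P₀.eval z)^[k]) x₀)) := by
  induction k with
  | zero => simpa using hx
  | succ k ih =>
    refine ⟨?_, ?_⟩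
    · simp only [Function.iterate_succ_apply']
      exact tendsto_eval19 P P₀ d hdeg hdeg₀ hconv _ _ ih.1
    · simp only [add_comm k 1, deriv_iter_add, deriv_iter_one]
      refine Tendsto.mul ?_ ih.2
      refine tendsto_eval19 _ _ d (fun n => ?_) ?_ ?_ _ _ ih.1
      · exact (Polynomial.natDegree_derivative_le _).trans (by have := hdeg n; omega)
      · exact (Polynomial.natDegree_derivative_le _).trans (by omega)
      · intro j
        simp only [Polynomial.coeff_derivative]
        exact (hconv _).mul tendsto_const_nhds

lemma pert19 (Ψ : ℂ × (ℂ × ℂ) → ℂ) (hΨ : ContDiff ℂ 2 Ψ) (Q : ℂ → ℂ) (hQ : ContDiff ℂ 2 Q)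
    (δ : ℝ) (hδ : 0 < δ)
    (K1 : Fin 3 → Set (ℂ × ℂ)) (hK1 : ∀ j, IsCompact (K1 j)) (T : Fin 3 → ℂ × ℂ → ℂ)
    (hT : ∀ j, Continuous (T j)) (h1 : ∀ j, ∀ x ∈ K1 j, ‖Ψ (0, x) - T j x‖ < δ)
    (K2 : Set (ℂ × ℂ)) (hK2 : IsCompact K2)
    (h2 : ∀ x ∈ K2, δ * ‖fderiv ℂ (fun x => Ψ (0, x)) x (1, 0)‖ +
      ‖fderiv ℂ (fun x => Ψ (0, x)) x (0, 1)‖ < δ / 2 * ‖deriv Q x.2‖) :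
    ∃ s0 : ℝ, 0 < s0 ∧ s0 < 1 ∧ ∀ s : ℂ, ‖s‖ ≤ s0 →
      (∀ j, ∀ x ∈ K1 j, ‖Ψ (s, x) - T j x‖ ≤ δ) ∧
      ContractsCone (fun x => (Ψ (s, x), Q x.2)) δ K2 := by
  have hL : Continuous (fun u : ℂ × (ℂ × ℂ) => fderiv ℂ (fun x => Ψ (u.1, x)) u.2) := by
    have := ContDiff.fderiv (𝕜 := ℂ) (m := 2) (n := 1) (f := fun (u : ℂ × (ℂ × ℂ)) x => Ψ (u.1, x))
      (g := fun u : ℂ × (ℂ × ℂ) => u.2) (hΨ.comp (by fun_prop)) (by fun_prop) (by norm_num)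
    exact this.continuous
  have hQ' : Continuous (deriv Q) := hQ.continuous_deriv (by norm_num)
  have e1 : ∀ j, ∀ᶠ s in 𝓝 (0:ℂ), ∀ x ∈ K1 j, ‖Ψ (s, x) - T j x‖ < δ := by
    intro j
    apply (hK1 j).eventually_forall_of_forall_eventually
    intro x hx
    have hc : Continuous (fun u : ℂ × (ℂ × ℂ) => ‖Ψ u - T j u.2‖) :=
      (hΨ.continuous.sub ((hT j).comp continuous_snd)).norm
    exact hc.continuousAt.eventually_lt continuousAt_const (h1 j x hx)
  have e2 : ∀ᶠ s in 𝓝 (0:ℂ), ∀ x ∈ K2, δ * ‖fderiv ℂ (fun x => Ψ (s, x)) x (1, 0)‖ +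
      ‖fderiv ℂ (fun x => Ψ (s, x)) x (0, 1)‖ < δ / 2 * ‖deriv Q x.2‖ := by
    apply hK2.eventually_forall_of_forall_eventually
    intro x hx
    have hc1 : Continuous (fun u : ℂ × (ℂ × ℂ) =>
      δ * ‖fderiv ℂ (fun x => Ψ (u.1, x)) u.2 (1, 0)‖ +
      ‖fderiv ℂ (fun x => Ψ (u.1, x)) u.2 (0, 1)‖) :=
      (continuous_const.mul (hL.clm_apply continuous_const).norm).add
        (hL.clm_apply continuous_const).norm
    have hc2 : Continuous (fun u : ℂ × (ℂ × ℂ) => δ / 2 * ‖deriv Q u.2.2‖) := by fun_prop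
    exact hc1.continuousAt.eventually_lt hc2.continuousAt (h2 x hx)
  obtain ⟨r, hr, hr'⟩ := Metric.eventually_nhds_iff.1 ((eventually_all.2 e1).and e2)
  refine ⟨min (r / 2) (1 / 2), by positivity, by
    exact (min_le_right _ _).trans_lt (by norm_num), fun s hs => ?_⟩
  obtain ⟨a1, a2⟩ := hr' (y := s) (by
    rw [dist_zero_right]
    exact (hs.trans (min_le_left _ _)).trans_lt (by linarith))
  refine ⟨fun j x hx => (a1 j x hx).le, 3 / 4 * δ, by positivity, by linarith, fun x hx v hv => ?_⟩
  have b := a2 x hx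
  have hd1 : HasFDerivAt (fun x => Ψ (s, x)) (fderiv ℂ (fun x => Ψ (s, x)) x) x := by
    have : ContDiff ℂ 2 (fun x => Ψ (s, x)) := hΨ.comp (by fun_prop)
    exact ((this.differentiable (by norm_num)) x).hasFDerivAt
  have hd2 : HasFDerivAt (fun x : ℂ × ℂ => Q x.2)
      ((ContinuousLinearMap.toSpanSingleton ℂ (deriv Q x.2)).comp
        (ContinuousLinearMap.snd ℂ ℂ ℂ)) x := by
    have : HasFDerivAt Q (ContinuousLinearMap.toSpanSingleton ℂ (deriv Q x.2)) x.2 :=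
      ((hQ.differentiable (by norm_num)) x.2).hasDerivAt.hasFDerivAt
    exact this.comp x hasFDerivAt_snd
  rw [(hd1.prodMk hd2).fderiv]
  generalize fderiv ℂ (fun x => Ψ (s, x)) x = L at *
  obtain ⟨v1, v2⟩ := v
  simp only [cone, mem_ofPred_eq] at hv ⊢
  have hv2 : 0 < ‖v2‖ := by
    by_contra h
    have h0 : ‖v2‖ = 0 := le_antisymm (not_lt.1 h) (norm_nonneg _)
    rw [h0, mul_zero] at hv
    exact absurd hv (not_lt.2 (norm_nonneg _))
  have hLv : L (v1, v2) = v1 * L (1, 0) + v2 * L (0, 1) := by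
    have : ((v1, v2) : ℂ × ℂ) = v1 • (1, 0) + v2 • (0, 1) := by simp
    rw [this, map_add, map_smul, map_smul]; simp
  simp only [ContinuousLinearMap.prod_apply, ContinuousLinearMap.comp_apply,
    ContinuousLinearMap.coe_snd', ContinuousLinearMap.toSpanSingleton_apply, smul_eq_mul, norm_mul]
  rw [hLv]
  have c1 : ‖v1 * L (1, 0) + v2 * L (0, 1)‖ ≤ ‖v1‖ * ‖L (1, 0)‖ + ‖v2‖ * ‖L (0, 1)‖ :=
    (norm_add_le _ _).trans (by rw [norm_mul, norm_mul])
  have c2 : ‖v1‖ * ‖L (1, 0)‖ ≤ δ * ‖v2‖ * ‖L (1, 0)‖ := by gcongr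
  have c3 := mul_lt_mul_of_pos_right b hv2
  have c4 : 0 ≤ δ * (‖v2‖ * ‖deriv Q x.2‖) := by positivity
  nlinarith

lemma sys_dist (S : AdmissibleSystem) (j : Fin 3) (b : ℕ) (w : ℂ) (hw : w ∈ S.V j b) :
    ‖w - S.r j‖ ≤ S.a₁ * S.a₂ ^ b := by
  have h := (Metric.edist_le_ediam_of_mem hw (S.hVmem j b)).trans (S.hVdiam j b)
  rw [edist_dist, ENNReal.ofReal_le_ofReal_iff (by have := S.ha₁; have := S.ha₂; positivity),
    dist_eq_norm] at h
  exact h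

lemma sys_bdd (S : AdmissibleSystem) : ∃ R : ℝ, 0 < R ∧ ∀ j b, S.V j b ⊆ closedBall 0 R := by
  have h1 := S.ha₁
  refine ⟨∑ j, ‖S.r j‖ + S.a₁, by positivity, fun j b w hw => ?_⟩
  rw [mem_closedBall_zero_iff]
  have h := sys_dist S j b w hw
  have h2 : S.a₁ * S.a₂ ^ b ≤ S.a₁ * 1 := by
    gcongr
    exact pow_le_one₀ S.ha₂.le S.ha₂'.le
  have h3 : ‖S.r j‖ ≤ ∑ j, ‖S.r j‖ :=
    Finset.single_le_sum (f := fun j => ‖S.r j‖) (fun i _ => norm_nonneg _) (Finset.mem_univ j)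
  have h4 : ‖w‖ ≤ ‖w - S.r j‖ + ‖S.r j‖ := by
    simpa using norm_add_le (w - S.r j) (S.r j)
  linarith

lemma sys_iter (S : AdmissibleSystem) (j : Fin 3) (a b : ℕ) (w : ℂ) (hw : w ∈ S.V j (b + a)) :
    (fun w => S.q.eval w)^[S.m₁ * a] w ∈ S.V j b := by
  induction a generalizing b with
  | zero => simpa using hw
  | succ a ih =>
    rw [Nat.mul_succ, add_comm, Function.iterate_add_apply]
    have := ih (b + 1) (by rw [show b + 1 + a = b + (a + 1) by ring]; exact hw)
    rw [← S.hVmap j b]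
    exact mem_image_of_mem _ this

lemma sys_iter_surj (S : AdmissibleSystem) (j : Fin 3) (a b : ℕ) (v : ℂ) (hv : v ∈ S.V j b) :
    ∃ w ∈ S.V j (b + a), (fun w => S.q.eval w)^[S.m₁ * a] w = v := by
  induction a generalizing b v with
  | zero => exact ⟨v, by simpa using hv, by simp⟩
  | succ a ih =>
    have hv' := hv
    rw [← S.hVmap j b] at hv'
    obtain ⟨u, hu, rfl⟩ := hv'
    obtain ⟨w, hw, rfl⟩ := ih (b + 1) u hu
    refine ⟨w, by rw [show b + (a + 1) = b + 1 + a by ring]; exact hw, ?_⟩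
    rw [Nat.mul_succ, add_comm, Function.iterate_add_apply]

lemma cont_deriv_iter (P : Polynomial ℂ) (k : ℕ) :
    Continuous (deriv ((fun z => P.eval z)^[k])) :=
  ((diff_iter P k).contDiff (n := 1)).continuous_deriv le_rfl

lemma contDiff_iter (P : Polynomial ℂ) (k : ℕ) :
    ContDiff ℂ 2 ((fun z => P.eval z)^[k]) := (diff_iter P k).contDiff

lemma sys_exp (S : AdmissibleSystem) : ∃ A χ : ℝ, 0 < A ∧ 1 < χ ∧ ∀ j b, ∀ w ∈ S.V j b,
    A * χ ^ b ≤ ‖deriv ((fun w => S.q.eval w)^[S.m₁ * b]) w‖ := by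
  obtain ⟨R, hR, hVR⟩ := sys_bdd S
  obtain ⟨χ, hχ1, hχ⟩ : ∃ χ : ℝ, 1 < χ ∧
      ∀ j, χ ≤ ‖deriv ((fun w => S.q.eval w)^[S.m₁]) (S.r j)‖ := by
    have : ∀ᶠ χ : ℝ in 𝓝[>] 1, ∀ j, χ ≤ ‖deriv ((fun w => S.q.eval w)^[S.m₁]) (S.r j)‖ :=
      eventually_all.2 fun j => (eventually_le_nhds (S.hrep j)).filter_mono nhdsWithin_le_nhds
    obtain ⟨χ, h1, h2⟩ := (this.and self_mem_nhdsWithin).exists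
    exact ⟨χ, h2, h1⟩
  have hχ0 : 0 < χ := by linarith
  have big : ∀ j b, S.l₀ ≤ b → ∀ w ∈ S.V j b,
      S.A * χ ^ b ≤ ‖deriv ((fun w => S.q.eval w)^[S.m₁ * b]) w‖ := by
    intro j b hb w hw
    have := S.hVexp b hb j w hw
    rw [mul_comm b] at this
    refine le_trans ?_ this
    have hA := S.hA
    have := hχ j
    gcongr
  have small : ∀ j b, ∃ c : ℝ, 0 < c ∧ (b < S.l₀ → ∀ w ∈ S.V j b,
      c * χ ^ b ≤ ‖deriv ((fun w => S.q.eval w)^[S.m₁ * b]) w‖) := by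
    intro j b
    by_cases hb : b < S.l₀
    swap
    · exact ⟨1, one_pos, fun h => absurd h hb⟩
    obtain ⟨M, hM⟩ := (isCompact_closedBall (0:ℂ) R).exists_bound_of_continuousOn
      (cont_deriv_iter S.q (S.m₁ * (S.l₀ - b))).continuousOn
    have hA := S.hA
    have hM' : 0 < max M 1 := by positivity
    refine ⟨S.A * χ ^ S.l₀ / max M 1 / χ ^ b, by positivity, fun _ v hv => ?_⟩
    obtain ⟨w, hw, rfl⟩ := sys_iter_surj S j (S.l₀ - b) b v hv
    have h1 := big j _ (by omega) w hw
    rw [show S.m₁ * (b + (S.l₀ - b)) = S.m₁ * b + S.m₁ * (S.l₀ - b) by ring,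
      show b + (S.l₀ - b) = S.l₀ by omega, deriv_iter_add, norm_mul] at h1
    have h2 := (hM w (hVR _ _ hw)).trans (le_max_left M 1)
    rw [div_mul_cancel₀ _ (by positivity), div_le_iff₀ hM']
    refine h1.trans ?_
    gcongr
  choose c hc0 hc using small
  have : ∀ᶠ A : ℝ in 𝓝[>] 0, (∀ j, ∀ b ∈ Finset.range S.l₀, A ≤ c j b) ∧ A ≤ S.A :=
    (eventually_all.2 fun j => (eventually_all_finset _).2 fun b _ =>
      (eventually_le_nhds (hc0 j b)).filter_mono nhdsWithin_le_nhds).and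
      ((eventually_le_nhds S.hA).filter_mono nhdsWithin_le_nhds)
  obtain ⟨A, ⟨h1, h2⟩, h3⟩ := (this.and self_mem_nhdsWithin).exists
  refine ⟨A, χ, h3, hχ1, fun j b w hw => ?_⟩
  by_cases hb : b < S.l₀
  · refine le_trans ?_ (hc j b hb w hw)
    have := h1 j b (Finset.mem_range.2 hb)
    gcongr
  · refine le_trans ?_ (big j b (not_lt.1 hb) w hw)
    gcongr

lemma geo19 (x : ℝ) (h0 : 0 ≤ x) (h1 : x < 1) (l : ℕ) :
    ∑ a ∈ Finset.range l, x ^ (l - a) ≤ (1 - x)⁻¹ := by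
  have e : ∑ a ∈ Finset.range l, x ^ (l - a) = ∑ k ∈ Finset.range l, x ^ (k + 1) := by
    rw [← Finset.sum_range_reflect]
    refine Finset.sum_congr rfl fun a ha => ?_
    have := Finset.mem_range.1 ha
    rw [show l - (l - 1 - a) = a + 1 by omega]
  rw [e, ← tsum_geometric_of_lt_one h0 h1]
  refine le_trans (Finset.sum_le_sum (g := fun k => x ^ k) fun k _ => ?_)
    ((summable_geometric_of_lt_one h0 h1).sum_le_tsum _ fun i _ => by positivity)
  exact pow_le_pow_of_le_one h0 h1.le (Nat.le_succ k)

lemma est1_19 (S : AdmissibleSystem) (B : ℂ → ℂ) (hB : Differentiable ℂ B) (R C Λ : ℝ)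
    (hR : ∀ j b, S.V j b ⊆ closedBall 0 R) (hC0 : 0 ≤ C) (hΛ : 0 ≤ Λ)
    (hC : ∀ w ∈ closedBall (0:ℂ) R, ‖deriv B w‖ ≤ C) (lam : ℂ) (l : ℕ)
    (hlam : ∀ a < l, ‖lam‖ ^ (l - 1 - a) ≤ Λ) (j : Fin 3) (w : ℂ) (hw : w ∈ S.V j l) :
    ‖∑ a ∈ Finset.range l, lam ^ (l - 1 - a) * B ((fun w => S.q.eval w)^[S.m₁ * a] w) -
      (∑ a ∈ Finset.range l, lam ^ (l - 1 - a)) * B (S.r j)‖ ≤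
      Λ * C * S.a₁ * (1 - S.a₂)⁻¹ := by
  have ha₁ := S.ha₁
  have ha₂ := S.ha₂
  rw [Finset.sum_mul, ← Finset.sum_sub_distrib]
  refine (norm_sum_le _ _).trans ?_
  have : ∀ a ∈ Finset.range l, ‖lam ^ (l - 1 - a) * B ((fun w => S.q.eval w)^[S.m₁ * a] w) -
      lam ^ (l - 1 - a) * B (S.r j)‖ ≤ Λ * C * S.a₁ * S.a₂ ^ (l - a) := by
    intro a ha
    have ha := Finset.mem_range.1 ha
    rw [← mul_sub, norm_mul, norm_pow]
    have hv : (fun w => S.q.eval w)^[S.m₁ * a] w ∈ S.V j (l - a) :=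
      sys_iter S j a (l - a) w (by rwa [show l - a + a = l by omega])
    have h1 := sys_dist S j _ _ hv
    have h2 := Convex.norm_image_sub_le_of_norm_deriv_le (𝕜 := ℂ) (f := B)
      (fun x _ => hB x) hC (convex_closedBall 0 R) (hR _ _ (S.hVmem j (l - a))) (hR _ _ hv)
    have h3 := hlam a ha
    calc _ ≤ Λ * (C * (S.a₁ * S.a₂ ^ (l - a))) := by
          gcongr
          exact h2.trans (by gcongr)
      _ = _ := by ring
  refine (Finset.sum_le_sum this).trans ?_
  rw [← Finset.mul_sum]
  have := geo19 S.a₂ ha₂.le S.ha₂' l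
  gcongr

lemma est2_19 (S : AdmissibleSystem) (B : ℂ → ℂ) (hB : Differentiable ℂ B) (R C Λ A χ : ℝ)
    (hR : ∀ j b, S.V j b ⊆ closedBall 0 R) (hC0 : 0 ≤ C) (hΛ : 0 ≤ Λ) (hA : 0 < A) (hχ : 1 < χ)
    (hexp : ∀ j b, ∀ w ∈ S.V j b,
      A * χ ^ b ≤ ‖deriv ((fun w => S.q.eval w)^[S.m₁ * b]) w‖)
    (hC : ∀ w ∈ closedBall (0:ℂ) R, ‖deriv B w‖ ≤ C) (lam : ℂ) (l : ℕ)
    (hlam : ∀ a < l, ‖lam‖ ^ (l - 1 - a) ≤ Λ) (j : Fin 3) (w : ℂ) (hw : w ∈ S.V j l) :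
    ‖deriv (fun w => ∑ a ∈ Finset.range l,
        lam ^ (l - 1 - a) * B ((fun w => S.q.eval w)^[S.m₁ * a] w)) w‖ ≤
      Λ * C * A⁻¹ * (1 - χ⁻¹)⁻¹ * ‖deriv ((fun w => S.q.eval w)^[S.m₁ * l]) w‖ := by
  have hχ0 : 0 < χ := by linarith
  have hd : HasDerivAt (fun w => ∑ a ∈ Finset.range l,
        lam ^ (l - 1 - a) * B ((fun w => S.q.eval w)^[S.m₁ * a] w))
      (∑ a ∈ Finset.range l, lam ^ (l - 1 - a) *
        (deriv B ((fun w => S.q.eval w)^[S.m₁ * a] w) *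
          deriv ((fun w => S.q.eval w)^[S.m₁ * a]) w)) w := by
    refine HasDerivAt.fun_sum fun a _ => HasDerivAt.const_mul _ ?_
    exact (hB _).hasDerivAt.comp w (diff_iter S.q (S.m₁ * a) w).hasDerivAt
  rw [hd.deriv]
  refine (norm_sum_le _ _).trans ?_
  set Qd := ‖deriv ((fun w => S.q.eval w)^[S.m₁ * l]) w‖ with hQd
  have : ∀ a ∈ Finset.range l, ‖lam ^ (l - 1 - a) *
        (deriv B ((fun w => S.q.eval w)^[S.m₁ * a] w) *
          deriv ((fun w => S.q.eval w)^[S.m₁ * a]) w)‖ ≤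
        Λ * C * A⁻¹ * Qd * χ⁻¹ ^ (l - a) := by
    intro a ha
    have ha := Finset.mem_range.1 ha
    rw [norm_mul, norm_mul, norm_pow]
    have hv : (fun w => S.q.eval w)^[S.m₁ * a] w ∈ S.V j (l - a) :=
      sys_iter S j a (l - a) w (by rwa [show l - a + a = l by omega])
    have h1 := hexp j _ _ hv
    have h2 := hC _ (hR _ _ hv)
    have h3 := hlam a ha
    have h4 : Qd = ‖deriv ((fun w => S.q.eval w)^[S.m₁ * (l - a)])
        ((fun w => S.q.eval w)^[S.m₁ * a] w)‖ * ‖deriv ((fun w => S.q.eval w)^[S.m₁ * a]) w‖ := by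
      rw [hQd, ← norm_mul, ← deriv_iter_add, ← Nat.mul_add, show l - a + a = l by omega]
    have h5 : ‖deriv ((fun w => S.q.eval w)^[S.m₁ * a]) w‖ ≤ Qd * A⁻¹ * χ⁻¹ ^ (l - a) := by
      have : A * χ ^ (l - a) * ‖deriv ((fun w => S.q.eval w)^[S.m₁ * a]) w‖ ≤ Qd := by
        rw [h4]; gcongr
      rw [inv_pow, ← div_eq_mul_inv, ← div_eq_mul_inv, div_div, le_div_iff₀ (by positivity)]
      linarith
    calc _ ≤ Λ * (C * (Qd * A⁻¹ * χ⁻¹ ^ (l - a))) := by gcongr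
      _ = _ := by ring
  refine (Finset.sum_le_sum this).trans ?_
  rw [← Finset.mul_sum]
  have := geo19 χ⁻¹ (by positivity) (inv_lt_one_of_one_lt₀ hχ) l
  have hQ0 : 0 ≤ Qd := norm_nonneg _
  calc _ ≤ Λ * C * A⁻¹ * Qd * (1 - χ⁻¹)⁻¹ := by gcongr
    _ = _ := by ring

lemma step19 (S : AdmissibleSystem) (P : Polynomial ℂ) (hp : (fun z => P.eval z)^[S.m₁] 0 = 0)
    (l : ℕ) (ρ' ε : ℂ) (t : Fin 3 → ℂ) (δ κ : ℝ) (hδ : 0 < δ) (hκ : 0 < κ) (lam : ℂ)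
    (hlam : lam = deriv ((fun z => P.eval z)^[S.m₁]) 0) (B : ℂ → ℂ)
    (hB : B = fun w => ∑ i ∈ Finset.range S.m₁,
        deriv ((fun z => P.eval z)^[S.m₁ - i - 1]) ((fun z => P.eval z)^[i + 1] 0) *
          (fun w => S.q.eval w)^[i] w)
    (W : ℂ → ℂ) (hW : W = fun w => ∑ a ∈ Finset.range l,
        lam ^ (l - 1 - a) * B ((fun w => S.q.eval w)^[S.m₁ * a] w))
    (h1 : ∀ j, ∀ z ∈ ball (0:ℂ) 2, ∀ w ∈ S.V j l,
      ‖lam ^ l * z + ε * W w - (ρ' * z + t j)‖ ≤ δ / 2)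
    (h2 : ∀ j, ∀ w ∈ S.V j l, δ * ‖lam ^ l‖ + ‖ε * deriv W w‖ ≤
      δ / 4 * ‖deriv ((fun w => S.q.eval w)^[S.m₁ * l]) w‖)
    (h3 : ∀ j, ∀ w ∈ S.V j l, κ ≤ ‖deriv ((fun w => S.q.eval w)^[S.m₁ * l]) w‖) :
    ∃ s0 : ℝ, 0 < s0 ∧ s0 < 1 ∧ ∀ s : ℂ, s ≠ 0 → ‖s‖ ≤ s0 →
      ∀ g : ℂ × ℂ → ℂ × ℂ, g = (fun x => ((P.eval (s * x.1) + s * ε * x.2) / s, S.q.eval x.2)) →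
      (∀ j, ∀ x ∈ ball (0:ℂ) 2 ×ˢ S.V j l, ‖(g^[S.m₁ * l] x).1 - (ρ' * x.1 + t j)‖ ≤ δ) ∧
      ContractsCone (g^[S.m₁ * l]) δ (closure (⋃ j : Fin 3, ball (0:ℂ) 1 ×ˢ S.V j l)) := by
  obtain ⟨R, hR0, hR⟩ := sys_bdd S
  have hWd : Differentiable ℂ W := by
    have hBd : Differentiable ℂ B := by
      rw [hB]
      exact Differentiable.fun_sum fun i _ => (diff_iter S.q i).const_mul _
    rw [hW]
    exact Differentiable.fun_sum fun a _ => (hBd.comp (diff_iter S.q (S.m₁ * a))).const_mul _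
  have hWc : Continuous (deriv W) := (hWd.contDiff (n := 1)).continuous_deriv le_rfl
  have hQc := cont_deriv_iter S.q (S.m₁ * l)
  have hΨ0 : ∀ x : ℂ × ℂ, ((ext19 P S.q ε)^[S.m₁ * l] (0, 0, x)).2.2.1 =
      lam ^ l * x.1 + ε * W x.2 := by
    intro x
    obtain ⟨z, w⟩ := x
    rw [ext19_zero_block P S.q ε z w S.m₁ l hp, hW, hB, hlam]
  have hbd : ∀ (j : Fin 3) (r : ℝ), ball (0:ℂ) r ×ˢ S.V j l ⊆ ball (0:ℂ) r ×ˢ closedBall 0 R :=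
    fun j r => prod_mono_right (hR j l)
  have hbd' : ∀ r, Bornology.IsBounded (ball (0:ℂ) r ×ˢ closedBall (0:ℂ) R) :=
    fun r => isBounded_ball.prod isBounded_closedBall
  have hfd : ∀ x : ℂ × ℂ, HasFDerivAt
      (fun x : ℂ × ℂ => ((ext19 P S.q ε)^[S.m₁ * l] (0, 0, x)).2.2.1)
      (lam ^ l • ContinuousLinearMap.fst ℂ ℂ ℂ +
        ε • ((ContinuousLinearMap.toSpanSingleton ℂ (deriv W x.2)).comp
          (ContinuousLinearMap.snd ℂ ℂ ℂ))) x := by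
    intro x
    rw [funext hΨ0]
    have : HasFDerivAt W (ContinuousLinearMap.toSpanSingleton ℂ (deriv W x.2)) x.2 :=
      (hWd x.2).hasDerivAt.hasFDerivAt
    exact (hasFDerivAt_fst.const_mul _).add ((this.comp x hasFDerivAt_snd).const_mul _)
  obtain ⟨s0, hs0, hs1, hs⟩ := pert19
    (fun u : ℂ × (ℂ × ℂ) => ((ext19 P S.q ε)^[S.m₁ * l] (u.1, 0, u.2)).2.2.1)
    (by
      have := (contDiff_ext19_iter P S.q ε (S.m₁ * l)).comp
        (f := fun u : ℂ × (ℂ × ℂ) => (u.1, (0:ℂ), u.2)) (by fun_prop)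
      exact this.snd.snd.fst)
    ((fun w => S.q.eval w)^[S.m₁ * l]) (contDiff_iter _ _) δ hδ
    (fun j => closure (ball (0:ℂ) 2 ×ˢ S.V j l))
    (fun j => ((hbd' 2).subset (hbd j 2)).isCompact_closure)
    (fun j x => ρ' * x.1 + t j) (fun j => by fun_prop)
    (by
      intro j x hx
      have hx2 : x ∈ {x : ℂ × ℂ | ‖lam ^ l * x.1 + ε * W x.2 - (ρ' * x.1 + t j)‖ ≤ δ / 2} := by
        refine closure_minimal (fun y hy => h1 j y.1 hy.1 y.2 hy.2) (isClosed_le ?_ ?_) hx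
        · have := hWd.continuous
          fun_prop
        · fun_prop
      rw [mem_ofPred_eq] at hx2
      simp only [hΨ0]
      linarith)
    (closure (⋃ j : Fin 3, ball (0:ℂ) 1 ×ˢ S.V j l))
    (((hbd' 1).subset (iUnion_subset fun j => hbd j 1)).isCompact_closure)
    (by
      intro x hx
      have hx2 : x ∈ {x : ℂ × ℂ | δ * ‖lam ^ l‖ + ‖ε * deriv W x.2‖ ≤
          δ / 4 * ‖deriv ((fun w => S.q.eval w)^[S.m₁ * l]) x.2‖} := by
        refine closure_minimal (iUnion_subset fun j y hy => h2 j y.2 hy.2) (isClosed_le ?_ ?_) hx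
        · fun_prop
        · fun_prop
      have hx3 : x ∈ {x : ℂ × ℂ | κ ≤ ‖deriv ((fun w => S.q.eval w)^[S.m₁ * l]) x.2‖} := by
        refine closure_minimal (iUnion_subset fun j y hy => h3 j y.2 hy.2) (isClosed_le ?_ ?_) hx
        · fun_prop
        · fun_prop
      rw [mem_ofPred_eq] at hx2 hx3
      rw [(hfd x).fderiv]
      simp
      simp at hx2
      have : 0 < δ * ‖deriv ((fun w => S.q.eval w)^[S.m₁ * l]) x.2‖ := by
        have := hκ.trans_le hx3
        positivity
      linarith)
  refine ⟨s0, hs0, hs1, fun s hs' hss g hg => ?_⟩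
  have hG : g^[S.m₁ * l] = fun x => (((ext19 P S.q ε)^[S.m₁ * l] (s, 0, x)).2.2.1,
      (fun w => S.q.eval w)^[S.m₁ * l] x.2) := by
    funext x
    have hc := ext19_iter_conj P S.q ε s hs' x (S.m₁ * l)
    refine Prod.ext ?_ ?_
    · rw [hg, hc.2.2, hc.2.1]
      have : (fun z => P.eval z)^[S.m₁ * l] 0 = 0 := by
        rw [Function.iterate_mul]
        exact Function.iterate_fixed hp l
      rw [this, zero_add]
      exact mul_div_cancel_left₀ _ hs'
    · exact base_iter g _ (fun x => by rw [hg]) _ x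
  rw [hG]
  exact ⟨fun j x hx => (hs s hss).1 j x (subset_closure hx), (hs s hss).2⟩
/-- The quantitative core of Theorem 4.1: let `(P_n)` be degree `d` polynomials with `0` an
`m₀`-periodic point, converging coefficientwise to `P₀`, with multipliers `ρ_n` of modulus `> 1`
converging to a primitive `t₀`-th root of unity `ρ₀`. Then for all `α₀, ε₀, δ₀ > 0` there are
integers `l_n ≥ l₀`, numbers `ρ'_n` with `|ρ'_n| = 1 + α₀`, radii `s_n ∈ (0,1)` and `N ≥ 1`
such that for `n ≥ N` and `0 < |s| ≤ s_n`, the `(m₁ l_n)`-th iterate `G` of the renormalized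
perturbed product map `g = φ_s⁻¹ ∘ f ∘ φ_s`, `f(z,w) = (P_n(z) + s ε_n w, q(w))`, is a skew
product over `q^{m₁ l_n}` which is `δ₀`-close to `(ρ'_n z + ε₀ cⱼ, q^{m₁ l_n}(w))` on
`2𝔻 × Vⱼ^{l_n}` and contracts the cone field `C_{δ₀}` on `closure (⋃ⱼ 𝔻 × Vⱼ^{l_n})`. -/
theorem stmt_19 (S : AdmissibleSystem) (m₀ t₀ : ℕ) (hm₀ : 1 ≤ m₀) (ht₀ : 1 ≤ t₀)
    (hm₁ : S.m₁ = m₀ * t₀)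
    (P : ℕ → Polynomial ℂ) (P₀ : Polynomial ℂ)
    (hdeg : ∀ n, (P n).natDegree = S.d) (hdeg₀ : P₀.natDegree = S.d)
    (hper : ∀ n, (fun z => (P n).eval z)^[m₀] 0 = 0)
    (hper₀ : (fun z => P₀.eval z)^[m₀] 0 = 0)
    (hconv : ∀ k : ℕ,
      Filter.Tendsto (fun n => (P n).coeff k) Filter.atTop (nhds (P₀.coeff k)))
    (hρn : ∀ n, 1 < ‖deriv ((fun z => (P n).eval z)^[m₀]) 0‖)
    (hρ₀t : deriv ((fun z => P₀.eval z)^[m₀]) 0 ^ t₀ = 1)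
    (hρ₀prim : ∀ k, 1 ≤ k → k < t₀ → deriv ((fun z => P₀.eval z)^[m₀]) 0 ^ k ≠ 1)
    (α₀ ε₀ δ₀ : ℝ) (hα₀ : 0 < α₀) (hε₀ : 0 < ε₀) (hδ₀ : 0 < δ₀) :
    ∃ (l : ℕ → ℕ) (ρ' : ℕ → ℂ) (s : ℕ → ℝ) (N : ℕ),
      1 ≤ N ∧ (∀ n, S.l₀ ≤ l n) ∧ (∀ n, ‖ρ' n‖ = 1 + α₀) ∧
      (∀ n, 0 < s n ∧ s n < 1) ∧
      ∀ n, N ≤ n → ∀ sc : ℂ, sc ≠ 0 → ‖sc‖ ≤ s n →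
        let ρn : ℂ := deriv ((fun z => (P n).eval z)^[m₀]) 0
        let εn : ℂ := (ε₀ : ℂ) * (ρn ^ t₀ - 1) / (ρn ^ (t₀ * l n) - 1)
        let g : ℂ × ℂ → ℂ × ℂ :=
          fun x => (((P n).eval (sc * x.1) + sc * εn * x.2) / sc, S.q.eval x.2)
        let G : ℂ × ℂ → ℂ × ℂ := g^[S.m₁ * l n]
        let c : Fin 3 → ℂ := fun j => ∑ i ∈ Finset.range S.m₁,
          deriv ((fun z => P₀.eval z)^[S.m₁ - i - 1]) ((fun z => P₀.eval z)^[i + 1] 0) *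
            (fun w => S.q.eval w)^[i] (S.r j)
        (∀ x : ℂ × ℂ, (G x).2 = (fun w => S.q.eval w)^[S.m₁ * l n] x.2) ∧
        (∀ j : Fin 3, ∀ x ∈ ball (0:ℂ) 2 ×ˢ S.V j (l n),
          ‖(G x).1 - (ρ' n * x.1 + (ε₀ : ℂ) * c j)‖ ≤ δ₀) ∧
        ContractsCone G δ₀ (closure (⋃ j : Fin 3, ball (0:ℂ) 1 ×ˢ S.V j (l n))) := by
  obtain ⟨R, hR0, hR⟩ := sys_bdd S
  obtain ⟨A, χ, hA, hχ, hexp⟩ := sys_exp S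
  have ha₁ := S.ha₁
  have ha₂ := S.ha₂
  have ha₂' := S.ha₂'
  have hdeg' : ∀ n, (P n).natDegree ≤ S.d := fun n => (hdeg n).le
  -- multipliers
  have hfix : ∀ n, (fun z => (P n).eval z)^[S.m₁] 0 = 0 := fun n => by
    rw [hm₁, Function.iterate_mul]; exact Function.iterate_fixed (hper n) t₀
  obtain ⟨lam, hlam⟩ : ∃ lam : ℕ → ℂ,
      lam = fun n => deriv ((fun z => (P n).eval z)^[m₀]) 0 ^ t₀ := ⟨_, rfl⟩
  have hlamd : ∀ n, lam n = deriv ((fun z => (P n).eval z)^[S.m₁]) 0 := fun n => by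
    rw [hm₁, Function.iterate_mul, hlam]
    exact (((diff_iter (P n) m₀ 0).hasDerivAt.iterate _ (hper n) t₀).deriv).symm
  have hlam1 : ∀ n, 1 < ‖lam n‖ := fun n => by
    rw [hlam]; simp only [norm_pow]; exact one_lt_pow₀ (hρn n) (by omega)
  have hlamt : Tendsto lam atTop (𝓝 1) := by
    rw [hlam, ← hρ₀t]
    exact (tendsto_deriv19 P P₀ S.d hdeg' hdeg₀.le hconv (fun _ => 0) 0
      tendsto_const_nhds m₀).2.pow t₀
  have hnt : Tendsto (fun n => ‖lam n‖) atTop (𝓝 1) := by simpa using hlamt.norm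
  have hst : Tendsto (fun n => ‖lam n - 1‖) atTop (𝓝 0) := by
    simpa using (hlamt.sub_const 1).norm
  -- coefficients
  obtain ⟨β, hβ⟩ : ∃ β : ℕ → ℕ → ℂ, β = fun n i =>
      deriv ((fun z => (P n).eval z)^[S.m₁ - i - 1]) ((fun z => (P n).eval z)^[i + 1] 0) :=
    ⟨_, rfl⟩
  obtain ⟨β₀, hβ₀⟩ : ∃ β₀ : ℕ → ℂ, β₀ = fun i =>
      deriv ((fun z => P₀.eval z)^[S.m₁ - i - 1]) ((fun z => P₀.eval z)^[i + 1] 0) :=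
    ⟨_, rfl⟩
  have hβt : ∀ i, Tendsto (fun n => β n i) atTop (𝓝 (β₀ i)) := by
    intro i
    rw [hβ, hβ₀]
    exact (tendsto_deriv19 P P₀ S.d hdeg' hdeg₀.le hconv _ _
      (tendsto_deriv19 P P₀ S.d hdeg' hdeg₀.le hconv (fun _ => 0) 0
        tendsto_const_nhds (i + 1)).1 (S.m₁ - i - 1)).2
  obtain ⟨B, hB⟩ : ∃ B : ℕ → ℂ → ℂ, B = fun n w => ∑ i ∈ Finset.range S.m₁,
      β n i * (fun w => S.q.eval w)^[i] w := ⟨_, rfl⟩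
  have hBd : ∀ n, Differentiable ℂ (B n) := by
    intro n
    rw [hB]
    exact Differentiable.fun_sum fun i _ => (diff_iter S.q i).const_mul _
  obtain ⟨c, hc⟩ : ∃ c : Fin 3 → ℂ, c = fun j => ∑ i ∈ Finset.range S.m₁,
      β₀ i * (fun w => S.q.eval w)^[i] (S.r j) := ⟨_, rfl⟩
  have hBt : ∀ j, Tendsto (fun n => ‖B n (S.r j) - c j‖) atTop (𝓝 0) := by
    intro j
    have : Tendsto (fun n => B n (S.r j)) atTop (𝓝 (c j)) := by
      rw [hB, hc]
      exact tendsto_finsetSum _ fun i _ => (hβt i).mul_const _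
    simpa using (this.sub_const (c j)).norm
  obtain ⟨C, hC0, hC⟩ : ∃ C : ℝ, 0 ≤ C ∧
      ∀ᶠ n in atTop, ∀ w ∈ closedBall (0:ℂ) R, ‖deriv (B n) w‖ ≤ C := by
    have hM : ∀ i, ∃ M : ℝ, ∀ w ∈ closedBall (0:ℂ) R,
        ‖deriv ((fun w => S.q.eval w)^[i]) w‖ ≤ M := fun i =>
      (isCompact_closedBall (0:ℂ) R).exists_bound_of_continuousOn
        (cont_deriv_iter S.q i).continuousOn
    choose M hM using hM
    have hM0 : ∀ i, 0 ≤ M i := fun i =>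
      (norm_nonneg _).trans (hM i 0 (mem_closedBall_self hR0.le))
    refine ⟨∑ i ∈ Finset.range S.m₁, (‖β₀ i‖ + 1) * M i,
      Finset.sum_nonneg fun i _ => mul_nonneg (by positivity) (hM0 i), ?_⟩
    have : ∀ᶠ n in atTop, ∀ i ∈ Finset.range S.m₁, ‖β n i‖ ≤ ‖β₀ i‖ + 1 :=
      (eventually_all_finset _).2 fun i _ =>
        (hβt i).norm.eventually_le_const (by linarith)
    filter_upwards [this] with n hn w hw
    have hd : HasDerivAt (B n) (∑ i ∈ Finset.range S.m₁,
        β n i * deriv ((fun w => S.q.eval w)^[i]) w) w := by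
      rw [hB]
      exact HasDerivAt.fun_sum fun i _ => (diff_iter S.q i w).hasDerivAt.const_mul _
    rw [hd.deriv]
    refine (norm_sum_le _ _).trans (Finset.sum_le_sum fun i hi => ?_)
    rw [norm_mul]
    have := hn i hi
    have := hM i w hw
    gcongr
  -- choice of the times
  have hl : ∀ n, ∃ k : ℕ, 1 + α₀ ≤ ‖lam n‖ ^ k ∧ ∀ i < k, ‖lam n‖ ^ i < 1 + α₀ := by
    intro n
    have hex : ∃ k : ℕ, 1 + α₀ ≤ ‖lam n‖ ^ k := by
      obtain ⟨k, hk⟩ := pow_unbounded_of_one_lt (1 + α₀) (hlam1 n)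
      exact ⟨k, hk.le⟩
    classical
    exact ⟨Nat.find hex, Nat.find_spec hex, fun i hi => not_le.1 (Nat.find_min hex hi)⟩
  choose k hk1 hk2 using hl
  have hkt : ∀ L : ℕ, ∀ᶠ n in atTop, L ≤ k n := by
    intro L
    have h1 : Tendsto (fun n => ‖lam n‖ ^ L) atTop (𝓝 1) := by simpa using hnt.pow L
    filter_upwards [h1.eventually_lt_const (show (1:ℝ) < 1 + α₀ by linarith)] with n hn
    by_contra hlt
    have := pow_le_pow_right₀ (hlam1 n).le (not_le.1 hlt).le
    linarith [hk1 n]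
  obtain ⟨L, hL⟩ : ∃ L : ℕ, 16 * (1 + α₀) / A < χ ^ L := pow_unbounded_of_one_lt _ hχ
  obtain ⟨l, hldef⟩ : ∃ l : ℕ → ℕ, l = fun n => max S.l₀ (k n) := ⟨_, rfl⟩
  obtain ⟨ρ', hρ'⟩ : ∃ ρ' : ℕ → ℂ, ρ' = fun n =>
    lam n ^ l n / (‖lam n ^ l n‖ : ℂ) * ((1 + α₀ : ℝ) : ℂ) := ⟨_, rfl⟩
  have hne : ∀ n, ‖lam n ^ l n‖ ≠ 0 := fun n => by
    have := hlam1 n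
    rw [norm_pow]; positivity
  have lim0 : ∀ (u : ℕ → ℝ) (K η : ℝ), Tendsto u atTop (𝓝 0) → 0 < η →
      ∀ᶠ n in atTop, K * u n ≤ η := by
    intro u K η hu hη
    have := hu.const_mul K
    rw [mul_zero] at this
    exact this.eventually_le_const hη
  have hev : ∀ᶠ n in atTop, ∃ s0 : ℝ, 0 < s0 ∧ s0 < 1 ∧ ∀ s : ℂ, s ≠ 0 → ‖s‖ ≤ s0 →
      ∀ g : ℂ × ℂ → ℂ × ℂ, g = (fun x => (((P n).eval (s * x.1) +
        s * ((ε₀ : ℂ) * (lam n - 1) / (lam n ^ l n - 1)) * x.2) / s, S.q.eval x.2)) →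
      (∀ j, ∀ x ∈ ball (0:ℂ) 2 ×ˢ S.V j (l n),
        ‖(g^[S.m₁ * l n] x).1 - (ρ' n * x.1 + (ε₀ : ℂ) * c j)‖ ≤ δ₀) ∧
      ContractsCone (g^[S.m₁ * l n]) δ₀
        (closure (⋃ j : Fin 3, ball (0:ℂ) 1 ×ˢ S.V j (l n))) := by
    filter_upwards [hC, hkt S.l₀, hkt L, hkt 1, hnt.eventually_le_const (show (1:ℝ) < 2 by norm_num),
      lim0 (fun n => ‖lam n‖ - 1) ((1 + α₀) * 2) (δ₀ / 6) (by simpa using hnt.sub_const 1)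
        (by positivity),
      eventually_all.2 fun j => lim0 _ ε₀ (δ₀ / 6) (hBt j) (by positivity),
      lim0 _ (ε₀ / α₀ * ((1 + α₀) * C * S.a₁ * (1 - S.a₂)⁻¹)) (δ₀ / 6) hst (by positivity),
      lim0 _ (ε₀ / α₀ * ((1 + α₀) * C * A⁻¹ * (1 - χ⁻¹)⁻¹)) (δ₀ / 8) hst (by positivity)]
      with n hCn hkl hkL hk1' hE2 hE3 hE4 hE5 hE6
    have hln : l n = k n := by rw [hldef]; exact max_eq_right hkl
    rw [hln]
    rw [hldef] at hρ'
    have hρn' : ρ' n = lam n ^ k n / (‖lam n ^ k n‖ : ℂ) * ((1 + α₀ : ℝ) : ℂ) := by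
      rw [hρ']; simp only [max_eq_right hkl]
    have hnk := hne n
    rw [hln] at hnk
    have hΛ : ∀ a < k n, ‖lam n‖ ^ (k n - 1 - a) ≤ 1 + α₀ := fun a ha =>
      (hk2 n _ (by omega)).le
    have hup : ‖lam n‖ ^ k n ≤ (1 + α₀) * ‖lam n‖ := by
      have := hk2 n (k n - 1) (by omega)
      calc ‖lam n‖ ^ k n = ‖lam n‖ ^ (k n - 1) * ‖lam n‖ := by
            rw [← pow_succ]; congr 1; omega
        _ ≤ _ := by gcongr
    have hlo := hk1 n
    have hden : α₀ ≤ ‖lam n ^ k n - 1‖ := by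
      have := norm_sub_norm_le (lam n ^ k n) 1
      rw [norm_one, norm_pow] at this
      linarith
    have hden0 : lam n ^ k n - 1 ≠ 0 := by
      intro h; rw [h, norm_zero] at hden; linarith
    have hεb : ‖(ε₀ : ℂ) * (lam n - 1) / (lam n ^ k n - 1)‖ ≤ ε₀ / α₀ * ‖lam n - 1‖ := by
      rw [norm_div, norm_mul, Complex.norm_real, Real.norm_of_nonneg hε₀.le]
      calc _ ≤ ε₀ * ‖lam n - 1‖ / α₀ := by gcongr
        _ = _ := by ring
    have hl1 : lam n - 1 ≠ 0 := by
      intro h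
      have := hlam1 n
      rw [sub_eq_zero.1 h, norm_one] at this
      exact lt_irrefl _ this
    have hgeo : (ε₀ : ℂ) * (lam n - 1) / (lam n ^ k n - 1) *
        (∑ a ∈ Finset.range (k n), lam n ^ (k n - 1 - a)) = ε₀ := by
      rw [Finset.sum_range_reflect (fun i => lam n ^ i) (k n),
        geom_sum_eq (sub_ne_zero.1 hl1)]
      field_simp
    refine step19 S (P n) (hfix n) (k n) (ρ' n) _ (fun j => (ε₀ : ℂ) * c j) δ₀ (A * χ ^ k n) hδ₀
      (by positivity) (lam n) (hlamd n) (B n) (by rw [hB, hβ]) _ rfl ?_ ?_ ?_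
    · intro j z hz w hw
      have e1 := est1_19 S (B n) (hBd n) R C (1 + α₀) hR hC0 (by positivity) hCn (lam n) (k n)
        hΛ j w hw
      set W := ∑ a ∈ Finset.range (k n),
        lam n ^ (k n - 1 - a) * B n ((fun w => S.q.eval w)^[S.m₁ * a] w)
      set ε := (ε₀ : ℂ) * (lam n - 1) / (lam n ^ k n - 1)
      set Γ := ∑ a ∈ Finset.range (k n), lam n ^ (k n - 1 - a)
      have hsplit : lam n ^ k n * z + ε * W - (ρ' n * z + ε₀ * c j) =
          (lam n ^ k n - ρ' n) * z + ε₀ * (B n (S.r j) - c j) + ε * (W - Γ * B n (S.r j)) := by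
        linear_combination (B n (S.r j)) * hgeo
      have f1 : ‖(lam n ^ k n - ρ' n) * z‖ ≤ δ₀ / 6 := by
        have g1 : lam n ^ k n - ρ' n = lam n ^ k n / (‖lam n ^ k n‖ : ℂ) *
            ((‖lam n ^ k n‖ - (1 + α₀) : ℝ) : ℂ) := by
          have : (‖lam n ^ k n‖ : ℂ) ≠ 0 := by exact_mod_cast hnk
          rw [hρn']
          push_cast
          field_simp
        rw [g1, norm_mul, norm_mul, norm_div, Complex.norm_real, Complex.norm_real, norm_norm,
          div_self hnk, one_mul, norm_pow, Real.norm_of_nonneg (by linarith)]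
        have hz' : ‖z‖ ≤ 2 := (mem_ball_zero_iff.1 hz).le
        calc _ ≤ ((1 + α₀) * (‖lam n‖ - 1)) * 2 := by
              gcongr
              · linarith
              · linarith
          _ ≤ _ := by linarith
      have f2 : ‖(ε₀ : ℂ) * (B n (S.r j) - c j)‖ ≤ δ₀ / 6 := by
        rw [norm_mul, Complex.norm_real, Real.norm_of_nonneg hε₀.le]
        exact hE4 j
      have f3 : ‖ε * (W - Γ * B n (S.r j))‖ ≤ δ₀ / 6 := by
        rw [norm_mul]
        calc _ ≤ ε₀ / α₀ * ‖lam n - 1‖ * ((1 + α₀) * C * S.a₁ * (1 - S.a₂)⁻¹) := by gcongr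
          _ ≤ _ := by linarith
      show ‖lam n ^ k n * z + ε * W - (ρ' n * z + ε₀ * c j)‖ ≤ δ₀ / 2
      rw [hsplit]
      refine (norm_add₃_le).trans ?_
      linarith
    · intro j w hw
      have e2 := est2_19 S (B n) (hBd n) R C (1 + α₀) A χ hR hC0 (by positivity) hA hχ hexp hCn
        (lam n) (k n) hΛ j w hw
      have e3 := hexp j _ w hw
      set Qd := ‖deriv ((fun w => S.q.eval w)^[S.m₁ * k n]) w‖
      have hQ0 : 0 ≤ Qd := norm_nonneg _
      rw [norm_mul, norm_pow]
      have f1 : δ₀ * ‖lam n‖ ^ k n ≤ δ₀ / 8 * Qd := by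
        have g1 : χ ^ L ≤ χ ^ k n := pow_le_pow_right₀ hχ.le hkL
        have g2 : 16 * (1 + α₀) ≤ A * χ ^ k n := by
          rw [div_lt_iff₀ hA] at hL
          have := mul_le_mul_of_nonneg_left g1 hA.le
          linarith
        have g3 : (1 + α₀) * ‖lam n‖ ≤ (1 + α₀) * 2 := by gcongr
        have g4 : ‖lam n‖ ^ k n ≤ Qd / 8 := by linarith
        have := mul_le_mul_of_nonneg_left g4 hδ₀.le
        linarith
      have f2 : ‖(ε₀ : ℂ) * (lam n - 1) / (lam n ^ k n - 1)‖ *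
          ‖deriv (fun w => ∑ a ∈ Finset.range (k n),
            lam n ^ (k n - 1 - a) * B n ((fun w => S.q.eval w)^[S.m₁ * a] w)) w‖ ≤
          δ₀ / 8 * Qd := by
        calc _ ≤ ε₀ / α₀ * ‖lam n - 1‖ * ((1 + α₀) * C * A⁻¹ * (1 - χ⁻¹)⁻¹ * Qd) := by gcongr
          _ = ε₀ / α₀ * ((1 + α₀) * C * A⁻¹ * (1 - χ⁻¹)⁻¹) * ‖lam n - 1‖ * Qd := by ring
          _ ≤ _ := by gcongr
      linarith
    · exact fun j w hw => hexp j _ w hw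
  obtain ⟨N, hN⟩ := eventually_atTop.1 hev
  have hall : ∀ n, ∃ s0 : ℝ, (0 < s0 ∧ s0 < 1) ∧ (max N 1 ≤ n → ∀ s : ℂ, s ≠ 0 → ‖s‖ ≤ s0 →
      ∀ g : ℂ × ℂ → ℂ × ℂ, g = (fun x => (((P n).eval (s * x.1) +
        s * ((ε₀ : ℂ) * (lam n - 1) / (lam n ^ l n - 1)) * x.2) / s, S.q.eval x.2)) →
      (∀ j, ∀ x ∈ ball (0:ℂ) 2 ×ˢ S.V j (l n),
        ‖(g^[S.m₁ * l n] x).1 - (ρ' n * x.1 + (ε₀ : ℂ) * c j)‖ ≤ δ₀) ∧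
      ContractsCone (g^[S.m₁ * l n]) δ₀
        (closure (⋃ j : Fin 3, ball (0:ℂ) 1 ×ˢ S.V j (l n)))) := by
    intro n
    by_cases hn : max N 1 ≤ n
    · obtain ⟨s0, h1, h2, h3⟩ := hN n ((le_max_left _ _).trans hn)
      exact ⟨s0, ⟨h1, h2⟩, fun _ => h3⟩
    · exact ⟨1 / 2, by norm_num, fun h => absurd h hn⟩
  choose s hs01 hs using hall
  refine ⟨l, ρ', s, max N 1, le_max_right _ _, fun n => ?_, fun n => ?_, hs01, ?_⟩
  · rw [hldef]; exact le_max_left _ _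
  · rw [hρ']
    simp only
    rw [norm_mul, norm_div, Complex.norm_real, Complex.norm_real, norm_norm, div_self (hne n),
      one_mul, Real.norm_of_nonneg (by linarith)]
  · intro n hn sc hsc hsn ρn εn g G c'
    have hcc : c' = c := by rw [hc, hβ₀]
    have hεn : εn = (ε₀ : ℂ) * (lam n - 1) / (lam n ^ l n - 1) := by
      simp only [εn, ρn, hlam, pow_mul]
    have hg := hs n hn sc hsc hsn g (by rw [← hεn])
    refine ⟨fun x => base_iter g _ (fun x => rfl) _ x, ?_, hg.2⟩
    rw [hcc]
    exact hg.1
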